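/- Let Z = (Z_h)_{h∈ℤ} be an E^ℤ-valued stochastic process on a probability space with P(Z = 0) = 0, E[‖Z_0‖^α] = 1 and E[‖Z_h‖^α] < ∞ for all h ∈ ℤ, where α > 0. Then the measure ν on E^ℤ defined by ν(A) = ∫_0^∞ P(rZ ∈ A) α r^{−α−1} dr for measurable A is a tail measure with index α, and moreover ν({x : ‖x_h‖ > 1}) = E[‖Z_h‖^α] for every h ∈ ℤ. -/

import Mathlib

open MeasureTheory
open scoped ENNReal

/-- A measurable cone: a measurable space `E` with a measurable multiplication by positive
scalars, a zero element and a measurable `1`-homogeneous pseudonorm. -/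
structure MeasCone (E : Type*) [MeasurableSpace E] where
  smul : ℝ → E → E
  zero : E
  nrm : E → ℝ
  measurable_smul : Measurable fun p : ℝ × E => smul p.1 p.2
  measurable_nrm : Measurable nrm
  one_smul : ∀ x, smul 1 x = x
  smul_smul : ∀ (u v : ℝ), 0 < u → 0 < v → ∀ x, smul u (smul v x) = smul (u * v) x
  smul_zero' : ∀ (u : ℝ), 0 < u → smul u zero = zero
  nrm_nonneg : ∀ x, 0 ≤ nrm x
  nrm_smul : ∀ (u : ℝ), 0 < u → ∀ x, nrm (smul u x) = u * nrm x
  eq_zero_of_nrm : ∀ x, nrm x = 0 → x = zero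

/-- The `k`-th iterate of the backshift operator: `(B^k x)_h = x_{h-k}`. -/
def seqShift {E : Type*} (k : ℤ) (x : ℤ → E) : ℤ → E := fun h => x (h - k)

/-- Shift invariance of a measure on `E^ℤ`: `ν(BA) = ν(A)` for all measurable `A`. -/
def ShiftInvariant {E : Type*} [MeasurableSpace E] (ν : MeasureTheory.Measure (ℤ → E)) : Prop :=
  ∀ A : Set (ℤ → E), MeasurableSet A → ν (seqShift 1 '' A) = ν A

namespace MeasCone

variable {E : Type*} [MeasurableSpace E] (K : MeasCone E)

/-- The sequence identically equal to the zero element. -/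
def zeroSeq : ℤ → E := fun _ => K.zero

/-- Componentwise scalar multiplication on the sequence space `E^ℤ`. -/
def sSmul (u : ℝ) (x : ℤ → E) : ℤ → E := fun h => K.smul u (x h)


/-- A tail measure with index `α > 0` on `E^ℤ`. -/
def IsTailMeasure (α : ℝ) (ν : Measure (ℤ → E)) : Prop :=
  ν {K.zeroSeq} = 0 ∧
  ν {x | 1 < K.nrm (x 0)} = 1 ∧
  (∀ h : ℤ, ν {x | 1 < K.nrm (x h)} < ⊤) ∧
  ∀ (u : ℝ), 0 < u → ∀ A : Set (ℤ → E), MeasurableSet A →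
    ν (K.sSmul u '' A) = ENNReal.ofReal (u ^ (-α)) * ν A

/-- The spectral map at lag `h`: `x ↦ x / ‖x_h‖`. -/
noncomputable def spectralMap (h : ℤ) (x : ℤ → E) : ℤ → E :=
  fun j => K.smul (K.nrm (x h))⁻¹ (x j)

/-- The law of the local spectral tail process of `ν` at lag `h`:
the pushforward under the spectral map of (the normalization of) the restriction of `ν`
to `{x : ‖x_h‖ > 1}`. -/
noncomputable def spectralLaw (ν : Measure (ℤ → E)) (h : ℤ) : Measure (ℤ → E) :=
  Measure.map (K.spectralMap h)
    ((ν {x | 1 < K.nrm (x h)})⁻¹ • ν.restrict {x | 1 < K.nrm (x h)})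

/-- The time change formula for (the law of) a process `Θ`:
`E[H₀(B^h Θ)] = E[‖Θ_h‖^α H₀(Θ)]` for every measurable `0`-homogeneous
`H₀ : E^ℤ → [0,∞)` vanishing on `{x : ‖x_0‖ = 0}`. -/
def SatisfiesTCF (α : ℝ) (μ : Measure (ℤ → E)) : Prop :=
  ∀ (h : ℤ) (H : (ℤ → E) → ℝ), Measurable H → (∀ x, 0 ≤ H x) →
    (∀ (u : ℝ), 0 < u → ∀ x, H (K.sSmul u x) = H x) →
    (∀ x, K.nrm (x 0) = 0 → H x = 0) →
    ∫⁻ x, ENNReal.ofReal (H (seqShift h x)) ∂μ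
      = ∫⁻ x, ENNReal.ofReal (K.nrm (x h) ^ α) * ENNReal.ofReal (H x) ∂μ

/-- `I(x) = j ∈ ℤ` for the infargmax functional:
`sup_{k ≤ j-1} ‖x_k‖ < ‖x_j‖ = sup_{k ∈ ℤ} ‖x_k‖`. -/
def IsInfArgmax (x : ℤ → E) (j : ℤ) : Prop :=
  (⨆ k : ℤ, ⨆ _ : k < j, ENNReal.ofReal (K.nrm (x k))) < ENNReal.ofReal (K.nrm (x j)) ∧
  ENNReal.ofReal (K.nrm (x j)) = ⨆ k : ℤ, ENNReal.ofReal (K.nrm (x k))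

end MeasCone

/-- The mass of `(1/c, ∞)` under the `α`-Pareto measure `α r^{-α-1} dr` is `c^α`. -/
theorem lintegral_indicator_one_lt_mul_rpow {α : ℝ} (hα : 0 < α) {c : ℝ} (hc : 0 ≤ c) :
    ∫⁻ r in Set.Ioi (0 : ℝ),
        {r : ℝ | 1 < r * c}.indicator (fun r => ENNReal.ofReal (α * r ^ (-α - 1))) r
      = ENNReal.ofReal (c ^ α) := by
  rcases hc.eq_or_lt with rfl | hc
  · simp [Real.zero_rpow hα.ne', not_lt.2 zero_le_one]
  · have hset : {r : ℝ | 1 < r * c} = Set.Ioi c⁻¹ := by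
      ext r
      simp only [Set.mem_ofPred_eq, Set.mem_Ioi]
      rw [inv_lt_iff_one_lt_mul₀ hc]
    have hci : 0 < c⁻¹ := inv_pos.2 hc
    rw [hset, setLIntegral_indicator measurableSet_Ioi, Set.inter_eq_left.2
      (Set.Ioi_subset_Ioi hci.le)]
    have hlt : -α - 1 < -1 := by linarith
    rw [← ofReal_integral_eq_lintegral_ofReal
      ((integrableOn_Ioi_rpow_of_lt hlt hci).const_mul α)]
    · rw [integral_const_mul, integral_Ioi_rpow_of_lt hlt hci, sub_add_cancel,
        Real.inv_rpow hc.le, Real.rpow_neg hc.le, inv_inv]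
      congr 1
      field_simp
    · filter_upwards [ae_restrict_mem measurableSet_Ioi] with r hr
      exact mul_nonneg hα.le (Real.rpow_nonneg (hci.trans hr).le _)

/-- Scaling the argument by `u⁻¹` multiplies an integral against `α r^{-α-1} dr` by `u^{-α}`. -/
theorem lintegral_comp_inv_mul_rpow (α : ℝ) {u : ℝ} (hu : 0 < u) (f : ℝ → ℝ≥0∞) :
    ∫⁻ r in Set.Ioi (0 : ℝ), f (u⁻¹ * r) * ENNReal.ofReal (α * r ^ (-α - 1))
      = ENNReal.ofReal (u ^ (-α)) *
        ∫⁻ r in Set.Ioi (0 : ℝ), f r * ENNReal.ofReal (α * r ^ (-α - 1)) := by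
  have himg : (fun r : ℝ => u * r) '' Set.Ioi 0 = Set.Ioi 0 := by
    rw [Set.image_mul_left_Ioi hu, mul_zero]
  conv_lhs => rw [← himg]
  rw [lintegral_image_eq_lintegral_abs_deriv_mul (f' := fun _ => u) measurableSet_Ioi
    (fun x _ => by simpa using ((hasDerivAt_id x).const_mul u).hasDerivWithinAt)
    (mul_right_injective₀ hu.ne').injOn,
    ← lintegral_const_mul' _ _ ENNReal.ofReal_ne_top]
  refine setLIntegral_congr_fun measurableSet_Ioi fun r hr => ?_
  have hr : 0 < r := hr
  have hpow : u * (α * (u * r) ^ (-α - 1)) = u ^ (-α) * (α * r ^ (-α - 1)) := by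
    rw [Real.mul_rpow hu.le hr.le, Real.rpow_sub_one hu.ne']
    field_simp
  simp only [inv_mul_cancel_left₀ hu.ne', abs_of_pos hu]
  rw [mul_left_comm, ← ENNReal.ofReal_mul hu.le, hpow, ENNReal.ofReal_mul (by positivity),
    mul_left_comm]

namespace MeasCone

variable {E : Type*} [MeasurableSpace E] (K : MeasCone E)

theorem nrm_zero : K.nrm K.zero = 0 := by
  have h := K.nrm_smul 2 two_pos K.zero
  rw [K.smul_zero' 2 two_pos] at h
  linarith

theorem nrm_eq_zero_iff {x : E} : K.nrm x = 0 ↔ x = K.zero :=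
  ⟨K.eq_zero_of_nrm x, fun h => h ▸ K.nrm_zero⟩

theorem measurable_nrm_apply (h : ℤ) : Measurable fun x : ℤ → E => K.nrm (x h) :=
  K.measurable_nrm.comp (measurable_pi_apply h)

theorem measurableSet_singleton_zeroSeq : MeasurableSet {K.zeroSeq} := by
  have h : ({K.zeroSeq} : Set (ℤ → E)) = ⋂ h : ℤ, {x | K.nrm (x h) = 0} := by
    ext x
    simp [funext_iff, zeroSeq, K.nrm_eq_zero_iff]
  rw [h]
  exact MeasurableSet.iInter fun h => K.measurable_nrm_apply h (measurableSet_singleton 0)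

theorem measurable_sSmul (u : ℝ) : Measurable (K.sSmul u) :=
  measurable_pi_lambda _ fun h =>
    K.measurable_smul.comp (measurable_const.prodMk (measurable_pi_apply h))

theorem sSmul_sSmul {u v : ℝ} (hu : 0 < u) (hv : 0 < v) (x : ℤ → E) :
    K.sSmul u (K.sSmul v x) = K.sSmul (u * v) x :=
  funext fun h => K.smul_smul u v hu hv (x h)

theorem one_sSmul (x : ℤ → E) : K.sSmul 1 x = x :=
  funext fun h => K.one_smul (x h)

theorem sSmul_image_eq_preimage {u : ℝ} (hu : 0 < u) (A : Set (ℤ → E)) :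
    K.sSmul u '' A = K.sSmul u⁻¹ ⁻¹' A := by
  refine congrFun (Set.image_eq_preimage_of_inverse (fun x => ?_) fun x => ?_) A
  · rw [K.sSmul_sSmul (inv_pos.2 hu) hu, inv_mul_cancel₀ hu.ne', K.one_sSmul]
  · rw [K.sSmul_sSmul hu (inv_pos.2 hu), mul_inv_cancel₀ hu.ne', K.one_sSmul]

theorem sSmul_eq_zeroSeq_iff {u : ℝ} (hu : 0 < u) {x : ℤ → E} :
    K.sSmul u x = K.zeroSeq ↔ x = K.zeroSeq := by
  simp only [funext_iff, sSmul, zeroSeq, ← K.nrm_eq_zero_iff, K.nrm_smul u hu,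
    mul_eq_zero, hu.ne', false_or]

/-- The Pareto mixture of the probabilities `P(r‖Z_h‖ > 1)` is the `α`-moment of `‖Z_h‖`. -/
theorem lintegral_measure_one_lt_nrm_sSmul {α : ℝ} (hα : 0 < α)
    {Ω : Type*} [MeasurableSpace Ω] (P : Measure Ω) [SFinite P]
    {Z : Ω → ℤ → E} (hZ : Measurable Z) (h : ℤ) :
    ∫⁻ r in Set.Ioi (0 : ℝ),
        P {ω | 1 < K.nrm (K.sSmul r (Z ω) h)} * ENNReal.ofReal (α * r ^ (-α - 1))
      = ∫⁻ ω, ENNReal.ofReal (K.nrm (Z ω h) ^ α) ∂P := by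
  have hN : Measurable fun ω => K.nrm (Z ω h) := (K.measurable_nrm_apply h).comp hZ
  have hS : MeasurableSet {p : ℝ × Ω | 1 < p.1 * K.nrm (Z p.2 h)} :=
    measurableSet_lt measurable_const (measurable_fst.mul (hN.comp measurable_snd))
  have hw : Measurable fun p : ℝ × Ω => ENNReal.ofReal (α * p.1 ^ (-α - 1)) := by fun_prop
  calc
    _ = ∫⁻ r in Set.Ioi (0 : ℝ), ∫⁻ ω, {p : ℝ × Ω | 1 < p.1 * K.nrm (Z p.2 h)}.indicator
          (fun p => ENNReal.ofReal (α * p.1 ^ (-α - 1))) (r, ω) ∂P := by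
      refine setLIntegral_congr_fun measurableSet_Ioi fun r hr => ?_
      have hset : {ω | 1 < K.nrm (K.sSmul r (Z ω) h)} = {ω | 1 < r * K.nrm (Z ω h)} := by
        simp only [sSmul, K.nrm_smul r hr]
      simp only [hset]
      rw [mul_comm, ← lintegral_indicator_const
        (measurableSet_lt measurable_const (hN.const_mul r))]
      rfl
    _ = ∫⁻ ω, (∫⁻ r in Set.Ioi (0 : ℝ), {p : ℝ × Ω | 1 < p.1 * K.nrm (Z p.2 h)}.indicator
          (fun p => ENNReal.ofReal (α * p.1 ^ (-α - 1))) (r, ω)) ∂P :=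
      lintegral_lintegral_swap (hw.indicator hS).aemeasurable
    _ = _ := lintegral_congr fun ω =>
      lintegral_indicator_one_lt_mul_rpow hα (K.nrm_nonneg (Z ω h))

end MeasCone

open MeasCone in
/-- the measure `ν(A) = ∫_0^∞ P(rZ ∈ A) α r^{-α-1} dr` associated to a process `Z`
with `P(Z = 0) = 0`, `E[‖Z_0‖^α] = 1` and `E[‖Z_h‖^α] < ∞` is a tail measure with index `α`,
and `ν({x : ‖x_h‖ > 1}) = E[‖Z_h‖^α]` for every `h`. -/
theorem isTailMeasure_of_stochasticRep
    {E : Type*} [MeasurableSpace E] (K : MeasCone E) (α : ℝ) (hα : 0 < α)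
    {Ω : Type*} [MeasurableSpace Ω] (P : Measure Ω) [IsProbabilityMeasure P]
    (Z : Ω → ℤ → E) (hZmeas : Measurable Z)
    (hZzero : P {ω | Z ω = K.zeroSeq} = 0)
    (hZone : ∫⁻ ω, ENNReal.ofReal (K.nrm (Z ω 0) ^ α) ∂P = 1)
    (hZfin : ∀ h : ℤ, ∫⁻ ω, ENNReal.ofReal (K.nrm (Z ω h) ^ α) ∂P < ⊤)
    (ν : Measure (ℤ → E))
    (hν : ∀ A : Set (ℤ → E), MeasurableSet A →
      ν A = ∫⁻ r in Set.Ioi (0 : ℝ),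
        P {ω | K.sSmul r (Z ω) ∈ A} * ENNReal.ofReal (α * r ^ (-α - 1)) ∂volume) :
    K.IsTailMeasure α ν ∧
      ∀ h : ℤ, ν {x | 1 < K.nrm (x h)} = ∫⁻ ω, ENNReal.ofReal (K.nrm (Z ω h) ^ α) ∂P := by
  have hmeas : ∀ h : ℤ, MeasurableSet {x : ℤ → E | 1 < K.nrm (x h)} := fun h =>
    measurableSet_lt measurable_const (K.measurable_nrm_apply h)
  have hmoment : ∀ h : ℤ,
      ν {x | 1 < K.nrm (x h)} = ∫⁻ ω, ENNReal.ofReal (K.nrm (Z ω h) ^ α) ∂P := fun h =>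
    (hν _ (hmeas h)).trans (K.lintegral_measure_one_lt_nrm_sSmul hα P hZmeas h)
  refine ⟨⟨?_, (hmoment 0).trans hZone, fun h => (hmoment h).trans_lt (hZfin h), ?_⟩, hmoment⟩
  · rw [hν _ K.measurableSet_singleton_zeroSeq]
    refine (setLIntegral_congr_fun measurableSet_Ioi fun r hr => ?_).trans lintegral_zero
    simp only [Set.mem_singleton_iff, K.sSmul_eq_zeroSeq_iff hr, hZzero, zero_mul]
  · intro u hu A hA
    rw [K.sSmul_image_eq_preimage hu, hν _ (K.measurable_sSmul u⁻¹ hA), hν A hA,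
      ← lintegral_comp_inv_mul_rpow α hu fun r => P {ω | K.sSmul r (Z ω) ∈ A}]
    refine setLIntegral_congr_fun measurableSet_Ioi fun r hr => ?_
    simp only [Set.mem_preimage, K.sSmul_sSmul (inv_pos.2 hu) hr]
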